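/- For an ergodic dynamical system (X, T, μ), for every q ≥ 0, every ε > 0, and every grid θ, the partition sums Γ_τ(ε,q) and Υ_τ(θ,ε,q) are finite, and the logarithmic partition sums Γ^l_τ(ε) and Υ^l_τ(θ,ε) are finite. -/

import Mathlib

open MeasureTheory Filter Set
open scoped ENNReal Topology NNReal

noncomputable section

/-- First return time of `x` to the set `A` under the map `T`;
by convention it is `0` if the orbit of `x` never returns to `A`. -/
def firstReturn {α : Type*} (T : α → α) (A : Set α) (x : α) : ℕ :=
  sInf {k : ℕ | 0 < k ∧ T^[k] x ∈ A}

/-- Extended logarithm `ℝ≥0∞ → EReal`. -/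
def elog (x : ℝ≥0∞) : EReal :=
  if x = 0 then ⊥ else if x = ⊤ then ⊤ else ((Real.log x.toReal : ℝ) : EReal)

section Generic

variable {α : Type*} [MeasurableSpace α] [PseudoMetricSpace α]

/-- The measure partition function `Γ_μ(ε,q)`. -/
def measPF (μ : Measure α) (ε q : ℝ) : ℝ≥0∞ :=
  ∫⁻ x, μ (Metric.ball x ε) ^ (q - 1) ∂μ

/-- The logarithmic measure partition function `Γ^l_μ(ε)`. -/
def measPFlog (μ : Measure α) (ε : ℝ) : ℝ :=
  ∫ x, Real.log (μ (Metric.ball x ε)).toReal ∂μ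

/-- The return time partition function `Γ_τ(ε,q)`. -/
def retPF (T : α → α) (μ : Measure α) (ε q : ℝ) : ℝ≥0∞ :=
  ∫⁻ x, (firstReturn T (Metric.ball x ε) x : ℝ≥0∞) ^ (1 - q) ∂μ

/-- The logarithmic return time partition function `Γ^l_τ(ε)`. -/
def retPFlog (T : α → α) (μ : Measure α) (ε : ℝ) : ℝ :=
  ∫ x, Real.log ((firstReturn T (Metric.ball x ε) x : ℝ))⁻¹ ∂μ

/-- The scaling exponent `(1/(q-1)) · log F(ε) / log ε`. -/
def dimScale (F : ℝ → ℝ≥0∞) (q : ℝ) (ε : ℝ) : EReal :=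
  ((((q - 1) * Real.log ε)⁻¹ : ℝ) : EReal) * elog (F ε)

/-- Upper generalized dimension obtained from a one-parameter family of partition
functions `F ε`, with the logarithmic convention at `q = 1`. -/
def dimPlus (F : ℝ → ℝ≥0∞) (Flog : ℝ → ℝ) (q : ℝ) : EReal :=
  if q = 1 then ((limsup (fun ε => Flog ε / Real.log ε) (𝓝[>] (0:ℝ)) : ℝ) : EReal)
  else limsup (dimScale F q) (𝓝[>] (0:ℝ))

/-- Lower generalized dimension. -/
def dimMinus (F : ℝ → ℝ≥0∞) (Flog : ℝ → ℝ) (q : ℝ) : EReal :=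
  if q = 1 then ((liminf (fun ε => Flog ε / Real.log ε) (𝓝[>] (0:ℝ)) : ℝ) : EReal)
  else liminf (dimScale F q) (𝓝[>] (0:ℝ))

/-- Generalized measure dimensions `D_μ^+(q)`. -/
def DmuPlus (μ : Measure α) (q : ℝ) : EReal :=
  dimPlus (fun ε => measPF μ ε q) (measPFlog μ) q

/-- Generalized measure dimensions `D_μ^-(q)`. -/
def DmuMinus (μ : Measure α) (q : ℝ) : EReal :=
  dimMinus (fun ε => measPF μ ε q) (measPFlog μ) q

/-- Return time generalized dimensions `D_τ^+(q)`. -/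
def DtauPlus (T : α → α) (μ : Measure α) (q : ℝ) : EReal :=
  dimPlus (fun ε => retPF T μ ε q) (retPFlog T μ) q

/-- Return time generalized dimensions `D_τ^-(q)`. -/
def DtauMinus (T : α → α) (μ : Measure α) (q : ℝ) : EReal :=
  dimMinus (fun ε => retPF T μ ε q) (retPFlog T μ) q

end Generic

/-- Euclidean space `ℝ^n`. -/
abbrev Euc (n : ℕ) := EuclideanSpace ℝ (Fin n)

/-- A grid in `ℝ^n` : a choice of origin and orientation, determining for every
side length `ε` a partition of `ℝ^n` into half-open cubes of side `ε`. -/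
structure Grid (n : ℕ) where
  origin : Euc n
  rot : Euc n ≃ₗᵢ[ℝ] Euc n

/-- Coordinates of a point w.r.t. a grid. -/
def Grid.coords {n : ℕ} (θ : Grid n) (x : Euc n) : Fin n → ℝ :=
  fun i => θ.rot.symm (x - θ.origin) i

/-- The cube `A_j` of side `ε` of the grid `θ`, indexed by `j : Fin n → ℤ`. -/
def Grid.box {n : ℕ} (θ : Grid n) (ε : ℝ) (j : Fin n → ℤ) : Set (Euc n) :=
  {x | ∀ i, (j i : ℝ) * ε ≤ θ.coords x i ∧ θ.coords x i < ((j i : ℝ) + 1) * ε}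

/-- The enlarged cube `Ā_j` of side `3ε` concentric with `A_j`. -/
def Grid.bigBox {n : ℕ} (θ : Grid n) (ε : ℝ) (j : Fin n → ℤ) : Set (Euc n) :=
  {x | ∀ i, ((j i : ℝ) - 1) * ε ≤ θ.coords x i ∧ θ.coords x i < ((j i : ℝ) + 2) * ε}

/-- Box measure partition function `Υ_μ(θ,ε,q) = Σ_{μ(A_j)>0} μ(A_j)^q`. -/
def boxMeasPF {n : ℕ} (μ : Measure (Euc n)) (θ : Grid n) (ε q : ℝ) : ℝ≥0∞ :=
  ∑' j : Fin n → ℤ, if μ (θ.box ε j) = 0 then 0 else μ (θ.box ε j) ^ q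

/-- Logarithmic box measure partition function `Υ^l_μ(θ,ε)`. -/
def boxMeasPFlog {n : ℕ} (μ : Measure (Euc n)) (θ : Grid n) (ε : ℝ) : ℝ :=
  ∑' j : Fin n → ℤ, (μ (θ.box ε j)).toReal * Real.log (μ (θ.box ε j)).toReal

/-- Return time box partition function `Υ_τ(θ,ε,q)`. -/
def boxRetPF {n : ℕ} (T : Euc n → Euc n) (μ : Measure (Euc n)) (θ : Grid n)
    (ε q : ℝ) : ℝ≥0∞ :=
  ∑' j : Fin n → ℤ, ∫⁻ x in θ.box ε j,
    (firstReturn T (θ.box ε j) x : ℝ≥0∞) ^ (1 - q) ∂μ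

/-- Logarithmic return time box partition function `Υ^l_τ(θ,ε)`. -/
def boxRetPFlog {n : ℕ} (T : Euc n → Euc n) (μ : Measure (Euc n)) (θ : Grid n)
    (ε : ℝ) : ℝ :=
  ∑' j : Fin n → ℤ, ∫ x in θ.box ε j,
    Real.log ((firstReturn T (θ.box ε j) x : ℝ))⁻¹ ∂μ

/-- Riedi's enhanced box partition function `Φ_μ(θ,ε,q)`. -/
def riediPF {n : ℕ} (μ : Measure (Euc n)) (θ : Grid n) (ε q : ℝ) : ℝ≥0∞ :=
  ∑' j : Fin n → ℤ, if μ (θ.box ε j) = 0 then 0 else μ (θ.bigBox ε j) ^ q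

/-- The enhanced box partition function `Ψ_μ(θ,ε,q) = Σ_{μ(A_j)>0} μ(A_j) μ(Ā_j)^{q-1}`. -/
def psiMeasPF {n : ℕ} (μ : Measure (Euc n)) (θ : Grid n) (ε q : ℝ) : ℝ≥0∞ :=
  ∑' j : Fin n → ℤ,
    if μ (θ.box ε j) = 0 then 0 else μ (θ.box ε j) * μ (θ.bigBox ε j) ^ (q - 1)

/-- The logarithmic enhanced box partition function `Ψ^l_μ(θ,ε)`. -/
def psiMeasPFlog {n : ℕ} (μ : Measure (Euc n)) (θ : Grid n) (ε : ℝ) : ℝ :=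
  ∑' j : Fin n → ℤ, (μ (θ.box ε j)).toReal * Real.log (μ (θ.bigBox ε j)).toReal

/-- The enhanced return time box partition function `Ψ_τ(θ,ε,q)`:
the integral is over `A_j` but the return is to the enlarged box `Ā_j`. -/
def psiRetPF {n : ℕ} (T : Euc n → Euc n) (μ : Measure (Euc n)) (θ : Grid n)
    (ε q : ℝ) : ℝ≥0∞ :=
  ∑' j : Fin n → ℤ, ∫⁻ x in θ.box ε j,
    (firstReturn T (θ.bigBox ε j) x : ℝ≥0∞) ^ (1 - q) ∂μ

/-- Box measure dimensions `Δ_μ^+(θ,q)`. -/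
def DeltaMuPlus {n : ℕ} (μ : Measure (Euc n)) (θ : Grid n) (q : ℝ) : EReal :=
  dimPlus (fun ε => boxMeasPF μ θ ε q) (boxMeasPFlog μ θ) q

/-- Box measure dimensions `Δ_μ^-(θ,q)`. -/
def DeltaMuMinus {n : ℕ} (μ : Measure (Euc n)) (θ : Grid n) (q : ℝ) : EReal :=
  dimMinus (fun ε => boxMeasPF μ θ ε q) (boxMeasPFlog μ θ) q

/-- Box return time dimensions `Δ_τ^+(θ,q)`. -/
def DeltaTauPlus {n : ℕ} (T : Euc n → Euc n) (μ : Measure (Euc n)) (θ : Grid n)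
    (q : ℝ) : EReal :=
  dimPlus (fun ε => boxRetPF T μ θ ε q) (boxRetPFlog T μ θ) q

/-- Box return time dimensions `Δ_τ^-(θ,q)`. -/
def DeltaTauMinus {n : ℕ} (T : Euc n → Euc n) (μ : Measure (Euc n)) (θ : Grid n)
    (q : ℝ) : EReal :=
  dimMinus (fun ε => boxRetPF T μ θ ε q) (boxRetPFlog T μ θ) q

end

section ReturnTimes

variable {α : Type*}

theorem firstReturn_pos {T : α → α} {A : Set α} {x : α} (h : ∃ k, 0 < k ∧ T^[k] x ∈ A) :
    0 < firstReturn T A x :=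
  (Nat.sInf_mem (s := {k : ℕ | 0 < k ∧ T^[k] x ∈ A}) h).1

theorem firstReturn_anti {T : α → α} {A B : Set α} {x : α} (hAB : A ⊆ B)
    (h : ∃ k, 0 < k ∧ T^[k] x ∈ A) : firstReturn T B x ≤ firstReturn T A x := by
  have hmem := Nat.sInf_mem (s := {k : ℕ | 0 < k ∧ T^[k] x ∈ A}) h
  exact Nat.sInf_le ⟨hmem.1, hAB hmem.2⟩

/-- The points whose orbit avoids `A` during the first `k` steps. -/
def avoidSet (T : α → α) (A : Set α) (k : ℕ) : Set α :=
  {x | ∀ j < k, T^[j] x ∉ A}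

theorem preimage_avoidSet (T : α → α) (A : Set α) (k : ℕ) :
    T ⁻¹' avoidSet T A k \ A = avoidSet T A (k + 1) := by
  ext x
  simp only [avoidSet, Set.mem_sdiff, mem_preimage, mem_ofPred_eq, ← Function.iterate_succ_apply]
  constructor
  · rintro ⟨h, hx⟩ (_ | j) hj
    · exact hx
    · exact h j (by omega)
  · intro h
    exact ⟨fun j hj => h (j + 1) (by omega), h 0 (by omega)⟩

variable [MeasurableSpace α]

theorem measurableSet_avoidSet {T : α → α} (hT : Measurable T) {A : Set α}
    (hA : MeasurableSet A) (k : ℕ) : MeasurableSet (avoidSet T A k) := by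
  have : avoidSet T A k = ⋂ j, ⋂ _ : j < k, (T^[j] ⁻¹' A)ᶜ := by
    ext x
    simp [avoidSet]
  rw [this]
  exact .iInter fun j => .iInter fun _ => (hT.iterate j hA).compl

theorem measurable_sInf_nat {S : ℕ → Set α} (hS : ∀ k, MeasurableSet (S k)) :
    Measurable fun x => sInf {k : ℕ | x ∈ S k} := by
  refine measurable_to_countable' fun m => ?_
  have : (fun x => sInf {k : ℕ | x ∈ S k}) ⁻¹' {m} =
      (S m ∩ ⋂ j, ⋂ _ : j < m, (S j)ᶜ) ∪ ({_x | m = 0} ∩ ⋂ k, (S k)ᶜ) := by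
    ext x
    simp only [mem_preimage, mem_singleton_iff, mem_union, mem_inter_iff, mem_iInter,
      mem_compl_iff, mem_ofPred_eq]
    constructor
    · rintro rfl
      by_cases h : ∃ k, x ∈ S k
      · exact .inl ⟨Nat.sInf_mem (s := {k : ℕ | x ∈ S k}) h,
          fun j hj => Nat.notMem_of_lt_sInf (s := {k : ℕ | x ∈ S k}) hj⟩
      · push Not at h
        exact .inr ⟨by simp [h], h⟩
    · rintro (⟨hm, hlt⟩ | ⟨rfl, h⟩)
      · refine le_antisymm (Nat.sInf_le hm) (le_of_not_gt fun hlt' => ?_)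
        exact hlt _ hlt' (Nat.sInf_mem (s := {k : ℕ | x ∈ S k}) ⟨m, hm⟩)
      · simp [h]
  rw [this]
  exact ((hS m).inter (.iInter fun j => .iInter fun _ => (hS j).compl)).union
    ((MeasurableSet.const _).inter (.iInter fun k => (hS k).compl))

/-- The inequality in Kac's lemma, valid for every measure preserving map. -/
theorem setLIntegral_firstReturn_le {T : α → α} {μ : Measure α} [IsFiniteMeasure μ]
    (hT : MeasurePreserving T μ μ) {A : Set α} (hA : MeasurableSet A) :
    ∫⁻ x in A, (firstReturn T A x : ℝ≥0∞) ∂μ ≤ μ univ := by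
  have hE := measurableSet_avoidSet hT.measurable hA
  have hpre k : MeasurableSet (T ⁻¹' avoidSet T A k) := hT.measurable (hE k)
  have hstep k : μ (T ⁻¹' avoidSet T A k ∩ A) + μ (avoidSet T A (k + 1)) =
      μ (avoidSet T A k) := by
    rw [← preimage_avoidSet, measure_inter_add_sdiff _ hA,
      hT.measure_preimage (hE k).nullMeasurableSet]
  have hsum N : ∑ k ∈ Finset.range N, μ (T ⁻¹' avoidSet T A k ∩ A) + μ (avoidSet T A N) =
      μ univ := by
    induction N with
    | zero => simp [avoidSet]
    | succ N ih => rw [Finset.sum_range_succ, add_assoc, hstep, ih]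
  calc ∫⁻ x in A, (firstReturn T A x : ℝ≥0∞) ∂μ
      ≤ ∫⁻ x in A, ∑' k, (T ⁻¹' avoidSet T A k).indicator 1 x ∂μ := by
        refine lintegral_mono fun x => ?_
        calc (firstReturn T A x : ℝ≥0∞)
            = ∑ k ∈ Finset.range (firstReturn T A x), (1 : ℝ≥0∞) := by simp
          _ = ∑ k ∈ Finset.range (firstReturn T A x),
                (T ⁻¹' avoidSet T A k).indicator (1 : α → ℝ≥0∞) x := by
              refine Finset.sum_congr rfl fun k hk => ?_
              rw [Finset.mem_range] at hk
              have hx : x ∈ T ⁻¹' avoidSet T A k := by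
                intro j hj hjA
                rw [← Function.iterate_succ_apply] at hjA
                have hlt : j + 1 < firstReturn T A x := by omega
                exact Nat.notMem_of_lt_sInf (s := {k : ℕ | 0 < k ∧ T^[k] x ∈ A}) hlt
                  ⟨j.succ_pos, hjA⟩
              simp [indicator_of_mem hx]
          _ ≤ _ := ENNReal.sum_le_tsum _
    _ = ∑' k, μ (T ⁻¹' avoidSet T A k ∩ A) := by
        rw [lintegral_tsum fun k => (measurable_one.indicator (hpre k)).aemeasurable]
        refine tsum_congr fun k => ?_
        rw [lintegral_indicator_one (hpre k), Measure.restrict_apply (hpre k)]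
    _ ≤ μ univ := by
        rw [ENNReal.tsum_eq_iSup_nat]
        exact iSup_le fun N => (hsum N) ▸ le_self_add

/-- Poincaré recurrence. -/
theorem ae_exists_return {T : α → α} {μ : Measure α} [IsFiniteMeasure μ]
    (hT : MeasurePreserving T μ μ) {A : Set α} (hA : MeasurableSet A) :
    ∀ᵐ x ∂μ, x ∈ A → ∃ k, 0 < k ∧ T^[k] x ∈ A := by
  filter_upwards [hT.conservative.ae_mem_imp_frequently_image_mem hA.nullMeasurableSet]
    with x hx hxA
  obtain ⟨k, hk, hkA⟩ := (frequently_atTop.1 (hx hxA)) 1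
  exact ⟨k, hk, hkA⟩

end ReturnTimes

section Comparison

variable {α : Type*} [MeasurableSpace α] [PseudoMetricSpace α] [OpensMeasurableSpace α]

theorem measurable_firstReturn_ball [SecondCountableTopology α] {T : α → α}
    (hT : Measurable T) (ε : ℝ) :
    Measurable fun x => firstReturn T (Metric.ball x ε) x := by
  refine measurable_sInf_nat (S := fun k => {x | 0 < k ∧ T^[k] x ∈ Metric.ball x ε}) fun k => ?_
  exact (MeasurableSet.const _).inter
    (measurableSet_lt ((hT.iterate k).dist measurable_id) measurable_const)

theorem ae_exists_return_ball [SecondCountableTopology α] {T : α → α} {μ : Measure α}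
    [IsFiniteMeasure μ]
    (hT : MeasurePreserving T μ μ) {ε : ℝ} (hε : 0 < ε) :
    ∀ᵐ x ∂μ, ∃ k, 0 < k ∧ T^[k] x ∈ Metric.ball x ε := by
  filter_upwards [hT.conservative.ae_frequently_mem_of_mem_nhds] with x hx
  obtain ⟨k, hk, hkA⟩ := (frequently_atTop.1 (hx _ (Metric.ball_mem_nhds x hε))) 1
  exact ⟨k, hk, hkA⟩

theorem lintegral_firstReturn_ball_ne_top {T : α → α} {μ : Measure α} [IsFiniteMeasure μ]
    (hT : MeasurePreserving T μ μ) {X : Set α} (hX : IsCompact X) (hXae : ∀ᵐ x ∂μ, x ∈ X)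
    {ε : ℝ} (hε : 0 < ε) :
    ∫⁻ x, (firstReturn T (Metric.ball x ε) x : ℝ≥0∞) ∂μ ≠ ⊤ := by
  obtain ⟨t, -, htfin, ht⟩ := hX.finite_cover_balls (half_pos hε)
  have := htfin.to_subtype
  have := Fintype.ofFinite t
  let A : t → Set α := fun c => Metric.ball c.1 (ε / 2)
  have hA c : MeasurableSet (A c) := Metric.isOpen_ball.measurableSet
  refine ne_top_of_le_ne_top (b := ∑ _c : t, μ univ)
    (ENNReal.sum_ne_top.2 fun _ _ => measure_ne_top μ univ) ?_
  calc ∫⁻ x, (firstReturn T (Metric.ball x ε) x : ℝ≥0∞) ∂μ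
      ≤ ∫⁻ x, ∑ c : t, (A c).indicator (fun y => (firstReturn T (A c) y : ℝ≥0∞)) x ∂μ := by
        refine lintegral_mono_ae ?_
        filter_upwards [hXae, ae_all_iff.2 fun c => ae_exists_return hT (hA c)] with x hxX hret
        obtain ⟨c, hc, hxc⟩ := mem_iUnion₂.1 (ht hxX)
        have hsub : A ⟨c, hc⟩ ⊆ Metric.ball x ε := Metric.ball_subset_ball' <| by
          rw [Metric.mem_ball, dist_comm] at hxc
          linarith
        refine le_trans ?_ (Finset.single_le_sum (fun _ _ => zero_le) (Finset.mem_univ ⟨c, hc⟩))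
        rw [indicator_of_mem (show x ∈ A ⟨c, hc⟩ from hxc)]
        exact_mod_cast firstReturn_anti hsub (hret ⟨c, hc⟩ hxc)
    _ = ∑ c : t, ∫⁻ x in A c, (firstReturn T (A c) x : ℝ≥0∞) ∂μ := by
        rw [lintegral_finsetSum]
        · simp_rw [lintegral_indicator (hA _)]
        · intro c _
          have hm : Measurable (firstReturn T (A c)) :=
            measurable_sInf_nat (S := fun k => {x | 0 < k ∧ T^[k] x ∈ A c}) fun k =>
              (MeasurableSet.const _).inter (hT.measurable.iterate k (hA c))
          exact (measurable_from_top.comp hm).indicator (hA c)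
    _ ≤ _ := Finset.sum_le_sum fun c _ => setLIntegral_firstReturn_le hT (hA c)

end Comparison

theorem natCast_rpow_one_sub_le {m : ℕ} (hm : 0 < m) {q : ℝ} (hq : 0 ≤ q) :
    (m : ℝ≥0∞) ^ (1 - q) ≤ m := by
  conv_rhs => rw [← ENNReal.rpow_one (m : ℝ≥0∞)]
  exact ENNReal.rpow_le_rpow_of_exponent_le (by exact_mod_cast hm) (by linarith)

theorem ofReal_log_natCast_le (m : ℕ) : ENNReal.ofReal (Real.log m) ≤ m := by
  rw [← ENNReal.ofReal_natCast]
  exact ENNReal.ofReal_le_ofReal (Real.log_le_self m.cast_nonneg)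

theorem ENNReal.tsum_ne_top_of_finite_support {ι : Type*} {f : ι → ℝ≥0∞} {s : Set ι}
    (hs : s.Finite) (h0 : ∀ i ∉ s, f i = 0) (hf : ∀ i, f i ≠ ⊤) : ∑' i, f i ≠ ⊤ := by
  rw [tsum_eq_sum (s := hs.toFinset) fun i hi => h0 i (by simpa using hi)]
  exact ENNReal.sum_ne_top.2 fun i _ => hf i

namespace Grid

variable {n : ℕ} (θ : Grid n)

theorem measurableSet_box (ε : ℝ) (j : Fin n → ℤ) : MeasurableSet (θ.box ε j) := by
  have hc i : Measurable fun x => θ.coords x i := by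
    have : Continuous fun x => θ.coords x i := by
      unfold coords
      fun_prop
    exact this.measurable
  have : θ.box ε j = ⋂ i, {x | (j i : ℝ) * ε ≤ θ.coords x i} ∩
      {x | θ.coords x i < ((j i : ℝ) + 1) * ε} := by
    ext x
    simp [box]
  rw [this]
  exact .iInter fun i => (measurableSet_le measurable_const (hc i)).inter
    (measurableSet_lt (hc i) measurable_const)

theorem finite_box_inter_nonempty {X : Set (Euc n)} (hX : Bornology.IsBounded X) {ε : ℝ}
    (hε : 0 < ε) : {j : Fin n → ℤ | (θ.box ε j ∩ X).Nonempty}.Finite := by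
  obtain ⟨R, hR⟩ := hX.subset_closedBall θ.origin
  refine (finite_Icc (fun _ => -⌈R / ε⌉ - 1) (fun _ => ⌈R / ε⌉)).subset ?_
  rintro j ⟨x, hxj, hxX⟩
  have hcoord i : |θ.coords x i| ≤ R := by
    calc |θ.coords x i| ≤ ‖θ.rot.symm (x - θ.origin)‖ := by
          simpa [coords] using PiLp.norm_apply_le (θ.rot.symm (x - θ.origin)) i
      _ = dist x θ.origin := by rw [LinearIsometryEquiv.norm_map, dist_eq_norm]
      _ ≤ R := hR hxX
  have hRε := Int.le_ceil (R / ε)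
  have hmul : R / ε * ε = R := div_mul_cancel₀ R hε.ne'
  refine ⟨fun i => ?_, fun i => ?_⟩
  · have h1 : -(R / ε) < (j i : ℝ) + 1 := by
      refine lt_of_mul_lt_mul_right ?_ hε.le
      have := (abs_le.1 (hcoord i)).1
      have := (hxj i).2
      linarith
    have h2 : ((-⌈R / ε⌉ - 1 : ℤ) : ℝ) ≤ j i := by
      push_cast
      linarith
    exact_mod_cast h2
  · have h1 : (j i : ℝ) ≤ R / ε := by
      refine le_of_mul_le_mul_right ?_ hε
      have := (abs_le.1 (hcoord i)).2
      have := (hxj i).1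
      linarith
    exact_mod_cast h1.trans hRε

end Grid

/-- For an ergodic dynamical system, for every `q ≥ 0`, `ε > 0` and grid `θ`,
the partition sums `Γ_τ(ε,q)` and `Υ_τ(θ,ε,q)` are finite, and the logarithmic partition
sums `Γ^l_τ(ε)` and `Υ^l_τ(θ,ε)` are finite. -/
theorem return_time_partition_sums_finite {n : ℕ} (T : Euc n → Euc n)
    (μ : Measure (Euc n)) [IsProbabilityMeasure μ] (X : Set (Euc n))
    (hXc : IsCompact X) (hX1 : μ X = 1) (hTX : Set.MapsTo T X X)
    (hErg : Ergodic T μ) :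
    ∀ q : ℝ, 0 ≤ q → ∀ ε : ℝ, 0 < ε → ∀ θ : Grid n,
      retPF T μ ε q ≠ ⊤ ∧
      boxRetPF T μ θ ε q ≠ ⊤ ∧
      MeasureTheory.Integrable
        (fun x => Real.log ((firstReturn T (Metric.ball x ε) x : ℝ))⁻¹) μ ∧
      (∑' j : Fin n → ℤ, ∫⁻ x in θ.box ε j,
          ENNReal.ofReal (Real.log (firstReturn T (θ.box ε j) x : ℝ)) ∂μ) ≠ ⊤ := by
  intro q hq ε hε θ
  have hT := hErg.toMeasurePreserving
  have hXae : ∀ᵐ x ∂μ, x ∈ X := (prob_compl_eq_zero_iff hXc.measurableSet).2 hX1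
  have hball := lintegral_firstReturn_ball_ne_top hT hXc hXae hε
  have hfin := θ.finite_box_inter_nonempty hXc.isBounded hε
  have hnull j (hj : j ∉ {j : Fin n → ℤ | (θ.box ε j ∩ X).Nonempty}) : μ (θ.box ε j) = 0 :=
    measure_mono_null (fun x hx hxX => hj ⟨x, hx, hxX⟩) hXae
  have hbox j : ∫⁻ x in θ.box ε j, (firstReturn T (θ.box ε j) x : ℝ≥0∞) ∂μ ≠ ⊤ :=
    ne_top_of_le_ne_top (measure_ne_top μ univ)
      (setLIntegral_firstReturn_le hT (θ.measurableSet_box ε j))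
  refine ⟨?_, ?_, ?_, ?_⟩
  · refine ne_top_of_le_ne_top hball (lintegral_mono_ae ?_)
    filter_upwards [ae_exists_return_ball hT hε] with x hx
    exact natCast_rpow_one_sub_le (firstReturn_pos hx) hq
  · refine ENNReal.tsum_ne_top_of_finite_support hfin
      (fun j hj => setLIntegral_measure_zero _ _ (hnull j hj)) fun j => ?_
    refine ne_top_of_le_ne_top (hbox j)
      (setLIntegral_mono_ae' (θ.measurableSet_box ε j) ?_)
    filter_upwards [ae_exists_return hT (θ.measurableSet_box ε j)] with x hx hxj
    exact natCast_rpow_one_sub_le (firstReturn_pos (hx hxj)) hq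
  · have hmeas := measurable_firstReturn_ball hT.measurable ε
    refine ⟨?_, ?_⟩
    · exact (measurable_from_top (f := fun m : ℕ => Real.log (m : ℝ)⁻¹).comp
        hmeas).aestronglyMeasurable
    · refine lt_of_le_of_lt (lintegral_mono fun x => ?_) hball.lt_top
      simp only [Real.log_inv, enorm_neg]
      rw [Real.enorm_of_nonneg (Real.log_natCast_nonneg _)]
      exact ofReal_log_natCast_le _
  · exact ENNReal.tsum_ne_top_of_finite_support hfin
      (fun j hj => setLIntegral_measure_zero _ _ (hnull j hj)) fun j =>
        ne_top_of_le_ne_top (hbox j) (lintegral_mono fun x => ofReal_log_natCast_le _)
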